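/- Let (E, {f_i}_{i=1}^m) ∈ 𝓔 with convex hull I = [a,b]. Then: (1) f_1(I) ∩ f_2(I) ≠ ∅ if and only if f_1(b) ∈ U_{ℵ₀}(E); and (2) f_{m−1}(I) ∩ f_m(I) ≠ ∅ if and only if f_m(a) ∈ U_{ℵ₀}(E). -/

import Mathlib

open Set Filter MeasureTheory

/-- A self-similar iterated function system on `ℝ` given by `m` similitudes
`f i x = r i * x + t i` (for `1 ≤ i ≤ m`, `m ≥ 3`), together with its attractor `E`:
the unique nonempty compact set with `E = ⋃_{i=1}^m f_i(E)`. -/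
structure ClassE where
  m : ℕ
  r : ℕ → ℝ
  t : ℕ → ℝ
  E : Set ℝ
  hm : 3 ≤ m
  hr : ∀ i, 1 ≤ i → i ≤ m → 0 < r i ∧ r i < 1
  hEne : E.Nonempty
  hEcpt : IsCompact E
  hEinv : E = ⋃ i ∈ Finset.Icc 1 m, (fun x => r i * x + t i) '' E

namespace ClassE

/-- The `i`-th similitude. -/
def f (S : ClassE) (i : ℕ) (x : ℝ) : ℝ := S.r i * x + S.t i

/-- Left endpoint `a` of the convex hull of `E`. -/
noncomputable def a (S : ClassE) : ℝ := sInf S.E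

/-- Right endpoint `b` of the convex hull of `E`. -/
noncomputable def b (S : ClassE) : ℝ := sSup S.E

/-- The convex hull `I = [a, b]` of `E`. -/
noncomputable def I (S : ClassE) : Set ℝ := Set.Icc S.a S.b

/-- Condition (A): `a = f_1(a) < f_2(a) < ⋯ < f_m(a) < f_m(b) = b`. -/
def condA (S : ClassE) : Prop :=
  S.f 1 S.a = S.a ∧ (∀ i, 1 ≤ i → i < S.m → S.f i S.a < S.f (i + 1) S.a) ∧
    S.f S.m S.a < S.f S.m S.b ∧ S.f S.m S.b = S.b

/-- Condition (B): `f_i(I) ∩ f_{i+2}(I) = ∅` for all `1 ≤ i ≤ m - 2`. -/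
def condB (S : ClassE) : Prop :=
  ∀ i, 1 ≤ i → i + 2 ≤ S.m → S.f i '' S.I ∩ S.f (i + 2) '' S.I = ∅

/-- Condition (C): there are `i, j ∈ {1, …, m-1}` with `f_i(I) ∩ f_{i+1}(I) = ∅` and
`f_j(I) ∩ f_{j+1}(I) ≠ ∅`. -/
def condC (S : ClassE) : Prop :=
  (∃ i, 1 ≤ i ∧ i + 1 ≤ S.m ∧ S.f i '' S.I ∩ S.f (i + 1) '' S.I = ∅) ∧
    (∃ j, 1 ≤ j ∧ j + 1 ≤ S.m ∧ S.f j '' S.I ∩ S.f (j + 1) '' S.I ≠ ∅)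

/-- Condition (D): whenever `f_i(I) ∩ f_{i+1}(I) ≠ ∅` there are `u, v ≥ 1` with
`f_i(I) ∩ f_{i+1}(I) = f_i ∘ f_m^u (I) = f_{i+1} ∘ f_1^v (I)`. -/
def condD (S : ClassE) : Prop :=
  ∀ i, 1 ≤ i → i + 1 ≤ S.m → S.f i '' S.I ∩ S.f (i + 1) '' S.I ≠ ∅ →
    ∃ u v : ℕ, 1 ≤ u ∧ 1 ≤ v ∧
      S.f i '' S.I ∩ S.f (i + 1) '' S.I = (S.f i ∘ (S.f S.m)^[u]) '' S.I ∧
      S.f i '' S.I ∩ S.f (i + 1) '' S.I = (S.f (i + 1) ∘ (S.f 1)^[v]) '' S.I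

/-- Membership in the class `𝓔`: conditions (A)–(D). -/
def goodE (S : ClassE) : Prop := S.condA ∧ S.condB ∧ S.condC ∧ S.condD

/-- `prefixMap d n = f_{d 0} ∘ f_{d 1} ∘ ⋯ ∘ f_{d (n-1)}`. -/
def prefixMap (S : ClassE) (d : ℕ → ℕ) : ℕ → ℝ → ℝ
  | 0 => id
  | n + 1 => S.prefixMap d n ∘ S.f (d n)

/-- `d : ℕ → ℕ` (with digits in `{1, …, m}`) is a coding of `x` if
`x = lim_n f_{d 0} ∘ ⋯ ∘ f_{d (n-1)} (0)`. -/
def isCoding (S : ClassE) (d : ℕ → ℕ) (x : ℝ) : Prop :=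
  (∀ n, 1 ≤ d n ∧ d n ≤ S.m) ∧
    Tendsto (fun n => S.prefixMap d n 0) atTop (nhds x)

/-- The set of codings of `x`. -/
def codings (S : ClassE) (x : ℝ) : Set (ℕ → ℕ) := {d | S.isCoding d x}

/-- `U k E`: the set of points of `E` having exactly `k` distinct codings
(`k` a cardinal; e.g. `k = ℵ₀` for countably infinitely many codings,
`k = 𝔠 = 2^ℵ₀` for a continuum of codings). -/
def U (S : ClassE) (k : Cardinal) : Set ℝ :=
  {x ∈ S.E | Cardinal.mk (S.codings x) = k}

end ClassE

open ClassE

namespace ClassE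

def cns (k : ℕ) (d : ℕ → ℕ) : ℕ → ℕ
  | 0 => k
  | n + 1 => d n

theorem cns_eta (d : ℕ → ℕ) : cns (d 0) (fun n => d (n + 1)) = d := by
  funext n; cases n <;> rfl

theorem cns_inj {k l : ℕ} {d e : ℕ → ℕ} (h : cns k d = cns l e) : k = l ∧ d = e := by
  refine ⟨congrFun h 0, ?_⟩
  funext n
  exact congrFun h (n + 1)

def agr (n : ℕ) (d e : ℕ → ℕ) : Prop := ∀ i < n, d i = e i

theorem agr_cns {n k : ℕ} {d e : ℕ → ℕ} (h : agr n d e) : agr (n + 1) (cns k d) (cns k e) := by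
  intro i hi
  cases i with
  | zero => rfl
  | succ i => exact h i (by omega)

theorem agr_iter {n p : ℕ} {d e : ℕ → ℕ} (h : agr n d e) (k : ℕ) :
    agr n ((cns p)^[k] d) ((cns p)^[k] e) := by
  induction k with
  | zero => exact h
  | succ k ih =>
    rw [Function.iterate_succ_apply', Function.iterate_succ_apply']
    intro i hi
    exact agr_cns ih i (by omega)

theorem comb (C : Set (ℕ → ℕ)) (w : ℕ → ℕ) (g : (ℕ → ℕ) → (ℕ → ℕ))
    (hw : w ∈ C) (hg : ∀ d ∈ C, g d ∈ C) (hC : ∀ d ∈ C, d = w ∨ ∃ e ∈ C, d = g e)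
    (hginj : Function.Injective g) (hwg : ∀ e, w ≠ g e)
    (hag : ∀ n d e, agr n d e → agr (n + 1) (g d) (g e)) :
    Cardinal.mk C = Cardinal.aleph0 := by
  have hmem : ∀ n, g^[n] w ∈ C := by
    intro n
    induction n with
    | zero => exact hw
    | succ n ih => rw [Function.iterate_succ_apply']; exact hg _ ih
  have hinf : C.Infinite := by
    refine Set.infinite_of_injective_forall_mem (f := fun n : ℕ => g^[n] w) ?_ hmem
    intro i
    induction i with
    | zero =>
      intro j hj
      cases j with
      | zero => rfl
      | succ j =>
        simp only [Function.iterate_succ_apply'] at hj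
        exact absurd hj (hwg _)
    | succ i ih =>
      intro j hj
      cases j with
      | zero =>
        simp only [Function.iterate_succ_apply'] at hj
        exact absurd hj.symm (hwg _)
      | succ j =>
        simp only [Function.iterate_succ_apply'] at hj
        rw [ih (hginj hj)]
  have hdec : ∀ n, ∀ d ∈ C, (∃ j, d = g^[j] w) ∨ ∃ e ∈ C, d = g^[n] e := by
    intro n
    induction n with
    | zero => intro d hd; exact Or.inr ⟨d, hd, rfl⟩
    | succ n ih =>
      intro d hd
      rcases ih d hd with h | ⟨e, he, rfl⟩
      · exact Or.inl h
      · rcases hC e he with rfl | ⟨e', he', rfl⟩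
        · exact Or.inl ⟨n, rfl⟩
        · exact Or.inr ⟨e', he', by rw [Function.iterate_succ_apply]⟩
  have hagn : ∀ n d e, agr n (g^[n] d) (g^[n] e) := by
    intro n d e
    induction n with
    | zero => intro i hi; omega
    | succ n ih =>
      rw [Function.iterate_succ_apply', Function.iterate_succ_apply']
      exact hag _ _ _ ih
  have hcount : C.Countable := by
    have h1 : (Set.range (fun n : ℕ => g^[n] w)).Countable := Set.countable_range _
    have h2 : ({d | ∀ n, ∃ e, d = g^[n] e} : Set (ℕ → ℕ)).Subsingleton := by
      intro d hd d' hd'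
      funext i
      obtain ⟨e, he⟩ := hd (i + 1)
      obtain ⟨e', he'⟩ := hd' (i + 1)
      rw [he, he']
      exact hagn (i + 1) e e' i (by omega)
    refine (h1.union h2.countable).mono ?_
    intro d hd
    by_cases h : ∃ j, d = g^[j] w
    · obtain ⟨j, rfl⟩ := h
      exact Or.inl ⟨j, rfl⟩
    · refine Or.inr fun n => ?_
      rcases hdec n d hd with h' | ⟨e, -, he⟩
      · exact absurd h' h
      · exact ⟨e, he⟩
  haveI := hcount.to_subtype
  haveI := hinf.to_subtype
  exact Cardinal.mk_eq_aleph0 _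

theorem f_lt (S : ClassE) {i : ℕ} (h1 : 1 ≤ i) (h2 : i ≤ S.m) {x y : ℝ} (h : x < y) :
    S.f i x < S.f i y := by
  have := mul_lt_mul_of_pos_left h (S.hr i h1 h2).1
  unfold f; linarith

theorem f_le (S : ClassE) {i : ℕ} (h1 : 1 ≤ i) (h2 : i ≤ S.m) {x y : ℝ} (h : x ≤ y) :
    S.f i x ≤ S.f i y := by
  have := mul_le_mul_of_nonneg_left h (S.hr i h1 h2).1.le
  unfold f; linarith

theorem f_inj (S : ClassE) {i : ℕ} (h1 : 1 ≤ i) (h2 : i ≤ S.m) {x y : ℝ}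
    (h : S.f i x = S.f i y) : x = y := by
  rcases lt_trichotomy x y with h' | h' | h'
  · have := S.f_lt h1 h2 h'; linarith
  · exact h'
  · have := S.f_lt h1 h2 h'; linarith

theorem f_surj (S : ClassE) {i : ℕ} (h1 : 1 ≤ i) (h2 : i ≤ S.m) (x : ℝ) :
    ∃ y, S.f i y = x := by
  have := (S.hr i h1 h2).1
  refine ⟨(x - S.t i) / S.r i, ?_⟩
  unfold f; field_simp; ring

theorem f_image (S : ClassE) {i : ℕ} (h1 : 1 ≤ i) (h2 : i ≤ S.m) (x y : ℝ) :
    S.f i '' Icc x y = Icc (S.f i x) (S.f i y) := by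
  ext z
  constructor
  · rintro ⟨w, ⟨hw1, hw2⟩, rfl⟩
    exact ⟨S.f_le h1 h2 hw1, S.f_le h1 h2 hw2⟩
  · rintro ⟨hz1, hz2⟩
    obtain ⟨w, rfl⟩ := S.f_surj h1 h2 z
    refine ⟨w, ⟨?_, ?_⟩, rfl⟩
    · by_contra h
      have := S.f_lt h1 h2 (not_le.1 h); linarith
    · by_contra h
      have := S.f_lt h1 h2 (not_le.1 h); linarith

theorem iter_image (S : ClassE) {i : ℕ} (h1 : 1 ≤ i) (h2 : i ≤ S.m) (x y : ℝ) (n : ℕ) :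
    (S.f i)^[n] '' Icc x y = Icc ((S.f i)^[n] x) ((S.f i)^[n] y) := by
  induction n with
  | zero => simp
  | succ n ih =>
    rw [Function.iterate_succ', Set.image_comp, ih, S.f_image h1 h2]; rfl

theorem a_mem (S : ClassE) : S.a ∈ S.E := S.hEcpt.sInf_mem S.hEne
theorem b_mem (S : ClassE) : S.b ∈ S.E := S.hEcpt.sSup_mem S.hEne
theorem E_sub (S : ClassE) {x : ℝ} (hx : x ∈ S.E) : x ∈ S.I :=
  ⟨csInf_le S.hEcpt.bddBelow hx, le_csSup S.hEcpt.bddAbove hx⟩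

theorem f_mem (S : ClassE) {i : ℕ} (h1 : 1 ≤ i) (h2 : i ≤ S.m) {x : ℝ} (hx : x ∈ S.E) :
    S.f i x ∈ S.E := by
  rw [S.hEinv]
  simp only [Set.mem_iUnion]
  exact ⟨i, Finset.mem_Icc.2 ⟨h1, h2⟩, x, hx, rfl⟩

theorem prefix_mem (S : ClassE) {d : ℕ → ℕ} (hd : ∀ n, 1 ≤ d n ∧ d n ≤ S.m) (n : ℕ) :
    ∀ x ∈ S.E, S.prefixMap d n x ∈ S.E := by
  induction n with
  | zero => intro x hx; exact hx
  | succ n ih => intro x hx; exact ih _ (S.f_mem (hd n).1 (hd n).2 hx)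

theorem exists_rho (S : ClassE) : ∃ ρ : ℝ, 0 ≤ ρ ∧ ρ < 1 ∧ ∀ i, 1 ≤ i → i ≤ S.m → S.r i ≤ ρ := by
  have hne : (Finset.Icc 1 S.m).Nonempty := ⟨1, Finset.mem_Icc.2 ⟨le_rfl, by have := S.hm; omega⟩⟩
  obtain ⟨j, hj, hmax⟩ := Finset.exists_max_image _ S.r hne
  rw [Finset.mem_Icc] at hj
  have := S.hr j hj.1 hj.2
  exact ⟨S.r j, this.1.le, this.2, fun i h1 h2 => hmax i (Finset.mem_Icc.2 ⟨h1, h2⟩)⟩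

theorem prefix_diff (S : ClassE) {ρ : ℝ} (h0 : 0 ≤ ρ)
    (hρ : ∀ i, 1 ≤ i → i ≤ S.m → S.r i ≤ ρ)
    {d : ℕ → ℕ} (hd : ∀ n, 1 ≤ d n ∧ d n ≤ S.m) (n : ℕ) :
    ∀ x y, |S.prefixMap d n x - S.prefixMap d n y| ≤ ρ ^ n * |x - y| := by
  induction n with
  | zero => intro x y; simp [prefixMap]
  | succ n ih =>
    intro x y
    refine (ih (S.f (d n) x) (S.f (d n) y)).trans ?_
    have e : S.f (d n) x - S.f (d n) y = S.r (d n) * (x - y) := by unfold f; ring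
    rw [e, abs_mul, abs_of_pos (S.hr _ (hd n).1 (hd n).2).1, pow_succ, mul_assoc]
    have := hρ _ (hd n).1 (hd n).2
    gcongr

theorem tendsto_diff (S : ClassE) {d : ℕ → ℕ} (hd : ∀ n, 1 ≤ d n ∧ d n ≤ S.m) (x y : ℝ) :
    Tendsto (fun n => S.prefixMap d n x - S.prefixMap d n y) atTop (nhds 0) := by
  obtain ⟨ρ, h0, h1, hρ⟩ := S.exists_rho
  refine squeeze_zero_norm (a := fun n => ρ ^ n * |x - y|) (fun n => ?_) ?_
  · rw [Real.norm_eq_abs]; exact S.prefix_diff h0 hρ hd n x y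
  · simpa using (tendsto_pow_atTop_nhds_zero_of_lt_one h0 h1).mul_const |x - y|

theorem coding_mem (S : ClassE) {d : ℕ → ℕ} {x : ℝ} (h : S.isCoding d x) : x ∈ S.I := by
  have h2 := (S.tendsto_diff h.1 S.a 0).add h.2
  simp only [sub_add_cancel, zero_add] at h2
  exact isClosed_Icc.mem_of_tendsto h2
    (Eventually.of_forall fun n => S.E_sub (S.prefix_mem h.1 n _ S.a_mem))

theorem prefix_cns (S : ClassE) (k : ℕ) (d : ℕ → ℕ) (n : ℕ) :
    ∀ x, S.prefixMap (cns k d) (n + 1) x = S.f k (S.prefixMap d n x) := by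
  induction n with
  | zero => intro x; rfl
  | succ n ih => intro x; exact ih (S.f (d n) x)

theorem coding_cns (S : ClassE) {k : ℕ} (h1 : 1 ≤ k) (h2 : k ≤ S.m) {d : ℕ → ℕ} {y : ℝ}
    (h : S.isCoding d y) : S.isCoding (cns k d) (S.f k y) := by
  refine ⟨fun n => ?_, ?_⟩
  · cases n with
    | zero => exact ⟨h1, h2⟩
    | succ n => exact h.1 n
  · rw [← tendsto_add_atTop_iff_nat 1]
    simp only [prefix_cns]
    unfold f
    exact (h.2.const_mul _).add_const _

theorem coding_uncns (S : ClassE) {d : ℕ → ℕ} {x : ℝ}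
    (h : S.isCoding d x) : ∃ k e y, d = cns k e ∧ 1 ≤ k ∧ k ≤ S.m ∧ y ∈ S.I ∧
      x = S.f k y ∧ S.isCoding e y := by
  have hk := h.1 0
  have hr := (S.hr _ hk.1 hk.2).1
  obtain ⟨y, hy⟩ := S.f_surj hk.1 hk.2 x
  have hc : S.isCoding (fun n => d (n + 1)) y := by
    refine ⟨fun n => h.1 (n + 1), ?_⟩
    have h2 := h.2
    rw [← tendsto_add_atTop_iff_nat 1, ← cns_eta d] at h2
    simp only [prefix_cns] at h2
    have h3 := (h2.sub_const (S.t (d 0))).div_const (S.r (d 0))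
    rw [← hy] at h3
    unfold f at h3
    simpa [cns, hr.ne'] using h3
  exact ⟨d 0, _, y, (cns_eta d).symm, hk.1, hk.2, S.coding_mem hc, hy.symm, hc⟩

theorem coding_iter (S : ClassE) {p : ℕ} (h1 : 1 ≤ p) (h2 : p ≤ S.m) {d : ℕ → ℕ} {y : ℝ}
    (h : S.isCoding d y) (k : ℕ) : S.isCoding ((cns p)^[k] d) ((S.f p)^[k] y) := by
  induction k with
  | zero => exact h
  | succ k ih =>
    rw [Function.iterate_succ_apply', Function.iterate_succ_apply']
    exact S.coding_cns h1 h2 ih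

theorem coding_const (S : ClassE) {w : ℕ} (h1 : 1 ≤ w) (h2 : w ≤ S.m) {z : ℝ}
    (h : S.f w z = z) : S.isCoding (fun _ => w) z := by
  have hd : ∀ n : ℕ, 1 ≤ (fun _ => w : ℕ → ℕ) n ∧ (fun _ => w : ℕ → ℕ) n ≤ S.m :=
    fun n => ⟨h1, h2⟩
  refine ⟨hd, ?_⟩
  have hz : ∀ n, S.prefixMap (fun _ => w) n z = z := by
    intro n
    induction n with
    | zero => rfl
    | succ n ih =>
      change S.prefixMap (fun _ => w) n (S.f w z) = z
      rw [h, ih]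
  have := (S.tendsto_diff hd 0 z).add_const z
  simpa [hz] using this

theorem core (S : ClassE) (P : Prop) {p q w : ℕ} {z : ℝ} (hpq : p ≠ q)
    (hp : 1 ≤ p ∧ p ≤ S.m) (hq : 1 ≤ q ∧ q ≤ S.m) (hw : 1 ≤ w ∧ w ≤ S.m)
    (hzE : z ∈ S.E) (hz : S.f w z = z)
    (L1 : ∀ i y, 1 ≤ i → i ≤ S.m → y ∈ S.I → S.f i y = z → i = w)
    (L2 : ∀ i y, 1 ≤ i → i ≤ S.m → y ∈ S.I → S.f i y = S.f p z → i = p ∨ (P ∧ i = q))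
    (L3 : P → ∀ k i y, 1 ≤ i → i ≤ S.m → y ∈ S.I → S.f i y = (S.f p)^[k + 2] z → i = p)
    (L4 : P → ∃ v : ℕ, 1 ≤ v ∧ S.f p z = S.f q ((S.f p)^[v] z)) :
    P ↔ S.f p z ∈ S.U Cardinal.aleph0 := by
  have hconst := S.coding_const hw.1 hw.2 hz
  have huniq : ∀ d, S.isCoding d z → d = fun _ => w := by
    have key : ∀ n d, S.isCoding d z → d n = w := by
      intro n
      induction n with
      | zero =>
        intro d hd
        obtain ⟨k, e, y, rfl, k1, k2, hy, hx, he⟩ := S.coding_uncns hd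
        exact L1 k y k1 k2 hy hx.symm
      | succ n ih =>
        intro d hd
        obtain ⟨k, e, y, rfl, k1, k2, hy, hx, he⟩ := S.coding_uncns hd
        have hk := L1 k y k1 k2 hy hx.symm
        subst hk
        have : y = z := S.f_inj k1 k2 (hx.symm.trans hz.symm)
        subst this
        exact ih e he
    intro d hd
    funext n
    exact key n d hd
  have hw0 : S.isCoding (cns p fun _ => w) (S.f p z) := S.coding_cns hp.1 hp.2 hconst
  constructor
  · intro hP
    refine ⟨S.f_mem hp.1 hp.2 hzE, ?_⟩
    obtain ⟨v, hv, hfv⟩ := L4 hP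
    obtain ⟨k, rfl⟩ : ∃ k, v = k + 1 := ⟨v - 1, by omega⟩
    have hback : ∀ k d, S.isCoding d ((S.f p)^[k + 1] z) →
        ∃ e, d = (cns p)^[k] e ∧ S.isCoding e (S.f p z) := by
      intro k
      induction k with
      | zero => intro d hd; exact ⟨d, rfl, hd⟩
      | succ k ih =>
        intro d hd
        obtain ⟨l, e, y, rfl, k1, k2, hy, hx, he⟩ := S.coding_uncns hd
        have hl := L3 hP k l y k1 k2 hy hx.symm
        subst hl
        rw [Function.iterate_succ_apply'] at hx
        have := S.f_inj k1 k2 hx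
        subst this
        obtain ⟨e', rfl, he'⟩ := ih e he
        exact ⟨e', by rw [Function.iterate_succ_apply'], he'⟩
    refine comb (S.codings (S.f p z)) (cns p fun _ => w) (fun d => cns q ((cns p)^[k] d))
      hw0 ?_ ?_ ?_ ?_ ?_
    · intro d hd
      change S.isCoding _ _
      rw [hfv, Function.iterate_succ_apply]
      exact S.coding_cns hq.1 hq.2 (S.coding_iter hp.1 hp.2 hd k)
    · intro d hd
      obtain ⟨l, e, y, rfl, k1, k2, hy, hx, he⟩ := S.coding_uncns hd
      rcases L2 l y k1 k2 hy hx.symm with rfl | ⟨-, rfl⟩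
      · left
        have := S.f_inj k1 k2 hx
        subst this
        rw [huniq e he]
      · right
        rw [hfv] at hx
        have := S.f_inj k1 k2 hx
        subst this
        obtain ⟨e', rfl, he'⟩ := hback k e he
        exact ⟨e', he', rfl⟩
    · intro d e h
      have hinj : Function.Injective (cns p) := fun d e h => (cns_inj h).2
      exact hinj.iterate k (cns_inj h).2
    · intro e h
      exact hpq (cns_inj h).1
    · intro n d e h
      exact agr_cns (agr_iter h k)
  · rintro ⟨-, hcard⟩
    by_contra hP
    have hsub : (S.codings (S.f p z)).Subsingleton := by
      have : ∀ d ∈ S.codings (S.f p z), d = cns p fun _ => w := by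
        intro d hd
        obtain ⟨l, e, y, rfl, k1, k2, hy, hx, he⟩ := S.coding_uncns hd
        rcases L2 l y k1 k2 hy hx.symm with rfl | ⟨h, -⟩
        · have := S.f_inj k1 k2 hx
          subst this
          rw [huniq e he]
        · exact absurd h hP
      intro d hd e he
      rw [this d hd, this e he]
    have hle := Cardinal.mk_le_one_iff_set_subsingleton.2 hsub
    rw [hcard] at hle
    exact absurd hle (not_le.2 Cardinal.one_lt_aleph0)

end ClassE

theorem stmt16 (S : ClassE) (hS : S.goodE) :
    (S.f 1 '' S.I ∩ S.f 2 '' S.I ≠ ∅ ↔ S.f 1 S.b ∈ S.U Cardinal.aleph0) ∧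
      (S.f (S.m - 1) '' S.I ∩ S.f S.m '' S.I ≠ ∅ ↔ S.f S.m S.a ∈ S.U Cardinal.aleph0) := by
  
  obtain ⟨⟨hA1, hA2, hA3, hA4⟩, hB, -, hD⟩ := hS
  have hm := S.hm
  have m1 : 1 ≤ S.m := by omega
  have hab : S.a < S.b := by
    by_contra h
    have := S.f_le m1 le_rfl (not_lt.1 h)
    linarith
  have haI : S.a ∈ S.I := ⟨le_rfl, hab.le⟩
  have hbI : S.b ∈ S.I := ⟨hab.le, le_rfl⟩
  have him : ∀ i, 1 ≤ i → i ≤ S.m → S.f i '' S.I = Icc (S.f i S.a) (S.f i S.b) :=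
    fun i h1 h2 => S.f_image h1 h2 _ _
  -- iterates of f_1 and f_m
  have fma : S.a < S.f S.m S.a := by
    have h := hA2 1 le_rfl (by omega)
    have : ∀ j, 2 ≤ j → j ≤ S.m → S.a < S.f j S.a := by
      intro j hj
      induction j, hj using Nat.le_induction with
      | base => intro _; linarith
      | succ j hj ih => intro hjm; have := ih (by omega); have := hA2 j (by omega) (by omega); linarith
    exact this _ (by omega) le_rfl
  have f1b : S.f 1 S.b < S.b := by
    have h := (S.hr 1 le_rfl m1)
    have h' : S.f 1 S.b - S.f 1 S.a = S.r 1 * (S.b - S.a) := by unfold ClassE.f; ring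
    have : S.r 1 * (S.b - S.a) < 1 * (S.b - S.a) := mul_lt_mul_of_pos_right h.2 (by linarith)
    linarith
  have itb : ∀ n, (S.f S.m)^[n] S.b = S.b := fun n => Function.iterate_fixed hA4 n
  have ita : ∀ n, (S.f 1)^[n] S.a = S.a := fun n => Function.iterate_fixed hA1 n
  have it1 : ∀ n, (S.f 1)^[n + 1] S.b ≤ S.f 1 S.b := by
    intro n
    induction n with
    | zero => exact le_rfl
    | succ n ih =>
      rw [Function.iterate_succ_apply']
      exact S.f_le le_rfl m1 (ih.trans f1b.le)
  have itm : ∀ n, S.f S.m S.a ≤ (S.f S.m)^[n + 1] S.a := by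
    intro n
    induction n with
    | zero => exact le_rfl
    | succ n ih =>
      rw [Function.iterate_succ_apply']
      exact S.f_le m1 le_rfl (fma.le.trans ih)
  have hDD : ∀ i, 1 ≤ i → i + 1 ≤ S.m → S.f i '' S.I ∩ S.f (i + 1) '' S.I ≠ ∅ →
      ∃ u v : ℕ, S.f (i + 1) S.a = S.f i ((S.f S.m)^[u + 1] S.a) ∧
        S.f i S.b = S.f (i + 1) ((S.f 1)^[v + 1] S.b) := by
    intro i h1 h2 h
    have hne := Set.nonempty_iff_ne_empty.2 h
    obtain ⟨u, v, hu, hv, e1, e2⟩ := hD i h1 h2 h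
    obtain ⟨u, rfl⟩ : ∃ k, u = k + 1 := ⟨u - 1, by omega⟩
    obtain ⟨v, rfl⟩ : ∃ k, v = k + 1 := ⟨v - 1, by omega⟩
    have e3 := e1.symm.trans e2
    rw [him i h1 (by omega), him (i + 1) (by omega) h2, Icc_inter_Icc] at hne e1
    rw [Set.image_comp, Set.image_comp, ClassE.I, S.iter_image m1 le_rfl, S.iter_image le_rfl m1,
      S.f_image h1 (by omega), S.f_image (by omega) h2, itb, ita] at e3
    have q := hne
    rw [e1, Set.image_comp, ClassE.I, S.iter_image m1 le_rfl, S.f_image h1 (by omega), itb] at q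
    have ql := Set.nonempty_Icc.1 q
    have q' := q
    rw [e3] at q'
    have ql' := Set.nonempty_Icc.1 q'
    have c1 : S.f i ((S.f S.m)^[u + 1] S.a) ∈ Icc (S.f (i + 1) S.a) (S.f (i + 1) ((S.f 1)^[v + 1] S.b)) := by
      rw [← e3]; exact ⟨le_rfl, ql⟩
    have c2 : S.f i S.b ∈ Icc (S.f (i + 1) S.a) (S.f (i + 1) ((S.f 1)^[v + 1] S.b)) := by
      rw [← e3]; exact ⟨ql, le_rfl⟩
    have c3 : S.f (i + 1) S.a ∈ Icc (S.f i ((S.f S.m)^[u + 1] S.a)) (S.f i S.b) := by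
      rw [e3]; exact ⟨le_rfl, ql'⟩
    have c4 : S.f (i + 1) ((S.f 1)^[v + 1] S.b) ∈ Icc (S.f i ((S.f S.m)^[u + 1] S.a)) (S.f i S.b) := by
      rw [e3]; exact ⟨ql', le_rfl⟩
    exact ⟨u, v, le_antisymm c3.1 c1.1 |>.symm ▸ rfl, le_antisymm c2.2 c4.2⟩
  have hgap : ∀ i, 1 ≤ i → i + 1 ≤ S.m → ¬ (S.f i '' S.I ∩ S.f (i + 1) '' S.I ≠ ∅) →
      S.f i S.b < S.f (i + 1) S.a := by
    intro i h1 h2 h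
    rw [not_not] at h
    by_contra hc
    have hlt := hA2 i h1 (by omega)
    have hmem : S.f (i + 1) S.a ∈ S.f i '' S.I ∩ S.f (i + 1) '' S.I := by
      rw [him i h1 (by omega), him (i + 1) (by omega) h2]
      exact ⟨⟨hlt.le, not_lt.1 hc⟩, le_rfl, S.f_le (by omega) h2 hab.le⟩
    rw [h] at hmem
    exact hmem
  have hgap2 : ∀ i, 1 ≤ i → i + 2 ≤ S.m → S.f i S.b < S.f (i + 2) S.a := by
    intro i h1 h2
    have h := hB i h1 h2
    by_contra hc
    have hlt := hA2 i h1 (by omega)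
    have hlt' := hA2 (i + 1) (by omega) (by omega)
    have hmem : S.f (i + 2) S.a ∈ S.f i '' S.I ∩ S.f (i + 2) '' S.I := by
      rw [him i h1 (by omega), him (i + 2) (by omega) h2]
      exact ⟨⟨(hlt.trans hlt').le, not_lt.1 hc⟩, le_rfl, S.f_le (by omega) h2 hab.le⟩
    rw [h] at hmem
    exact hmem
  have hbstep : ∀ i, 1 ≤ i → i + 1 ≤ S.m → S.f i S.b < S.f (i + 1) S.b := by
    intro i h1 h2
    by_cases h : S.f i '' S.I ∩ S.f (i + 1) '' S.I ≠ ∅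
    · obtain ⟨u, v, -, e⟩ := hDD i h1 h2 h
      rw [e]
      exact S.f_lt (by omega) h2 ((it1 v).trans_lt f1b)
    · exact (hgap i h1 h2 h).trans (S.f_lt (by omega) h2 hab)
  have monoA : ∀ i j, 1 ≤ i → i ≤ j → j ≤ S.m → S.f i S.a ≤ S.f j S.a := by
    intro i j hi hj
    induction j, hj using Nat.le_induction with
    | base => intro _; exact le_rfl
    | succ j hj ih => intro hjm; exact (ih (by omega)).trans (hA2 j (by omega) (by omega)).le
  have monoB : ∀ i j, 1 ≤ i → i ≤ j → j ≤ S.m → S.f i S.b ≤ S.f j S.b := by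
    intro i j hi hj
    induction j, hj using Nat.le_induction with
    | base => intro _; exact le_rfl
    | succ j hj ih => intro hjm; exact (ih (by omega)).trans (hbstep j (by omega) (by omega)).le
  obtain ⟨n, hn⟩ : ∃ n, S.m = n + 2 + 1 := ⟨S.m - 3, by omega⟩
  have hn1 : S.m - 1 = n + 2 := by omega
  have sep : S.f 1 S.b < S.f S.m S.a :=
    (hgap2 1 le_rfl (by omega)).trans_le (monoA _ _ (by omega) (by omega) le_rfl)
  constructor
  · refine S.core _ (p := 1) (q := 2) (w := S.m) (by omega) ⟨le_rfl, m1⟩ ⟨by omega, by omega⟩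
      ⟨m1, le_rfl⟩ S.b_mem hA4 ?_ ?_ ?_ ?_
    · intro i y h1 h2 hy h
      by_contra hne
      have c1 := S.f_le h1 h2 hy.2
      have c2 := hbstep i h1 (by omega)
      have c3 := monoB (i + 1) S.m (by omega) (by omega) le_rfl
      linarith
    · intro i y h1 h2 hy h
      by_contra hne
      rw [not_or, not_and] at hne
      have c1 := S.f_le h1 h2 hy.1
      by_cases h3 : i = 2
      · subst h3
        have := hgap 1 le_rfl (by omega) (fun hP => hne.2 hP rfl)
        norm_num at this
        linarith
      · have := hgap2 1 le_rfl (by omega)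
        have := monoA (1 + 2) i (by omega) (by omega) h2
        linarith
    · intro hP k i y h1 h2 hy h
      by_contra hne
      obtain ⟨u, v, e, -⟩ := hDD 1 le_rfl (by omega) hP
      have c1 := S.f_le h1 h2 hy.1
      have c2 := monoA (1 + 1) i (by omega) (by omega) h2
      rw [Function.iterate_succ_apply'] at h
      have c3 := S.f_lt le_rfl m1 ((it1 k).trans_lt (sep.trans_le (itm u)))
      linarith
    · intro hP
      obtain ⟨u, v, -, e⟩ := hDD 1 le_rfl (by omega) hP
      exact ⟨v + 1, by omega, e⟩
  · rw [hn1]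
    refine S.core _ (p := S.m) (q := n + 2) (w := 1) (by omega) ⟨m1, le_rfl⟩ ⟨by omega, by omega⟩
      ⟨le_rfl, m1⟩ S.a_mem hA1 ?_ ?_ ?_ ?_
    · intro i y h1 h2 hy h
      by_contra hne
      have c1 := S.f_le h1 h2 hy.1
      have c2 := hA2 1 le_rfl (by omega)
      have c3 := monoA (1 + 1) i (by omega) (by omega) h2
      linarith
    · intro i y h1 h2 hy h
      by_contra hne
      rw [not_or, not_and] at hne
      have c1 := S.f_le h1 h2 hy.2
      by_cases h3 : i = n + 2
      · subst h3
        rw [hn] at hne h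
        have := hgap (n + 2) (by omega) (by omega) (fun hP => hne.2 hP rfl)
        linarith
      · have c2 := hgap2 (n + 1) (by omega) (by omega)
        have c3 := monoB i (n + 1) (by omega) (by omega) (by omega)
        have e : n + 1 + 2 = S.m := by omega
        rw [e] at c2
        linarith
    · intro hP k i y h1 h2 hy h
      by_contra hne
      rw [hn] at hP
      obtain ⟨u, v, -, e⟩ := hDD (n + 2) (by omega) (by omega) hP
      rw [← hn] at e
      have c1 := S.f_le h1 h2 hy.2
      have c2 := monoB i (n + 2) (by omega) (by omega) (by omega)
      rw [Function.iterate_succ_apply'] at h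
      have c3 := S.f_lt m1 le_rfl ((it1 v).trans_lt (sep.trans_le (itm k)))
      linarith
    · intro hP
      rw [hn] at hP
      obtain ⟨u, v, e, -⟩ := hDD (n + 2) (by omega) (by omega) hP
      rw [← hn] at e
      exact ⟨u + 1, by omega, e⟩
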